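/- arXiv:2212.07137 — 7 statements merged into one kernel-verified Lean document; each statement's English description precedes it below -/
import Mathlib

section
/- Let ε > 0. For every u in the range of A − iε·I (respectively, of A + iε·I) with ‖u‖ = 1, the distance from u to the range of A satisfies dist(u, ran A) ≤ ε·C. -/
open Complex Filter
open scoped ComplexInnerProductSpace

noncomputable section

variable {H : Type*} [NormedAddCommGroup H] [InnerProductSpace ℂ H] [CompleteSpace H]

/-- The eigenspace `ker (T - z·1)` of a partially defined linear operator `T`. -/
def pKer (T : H →ₗ.[ℂ] H) (z : ℂ) : Submodule ℂ H where
  carrier := {u : H | ∃ hu : u ∈ T.domain, T ⟨u, hu⟩ = z • u}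
  zero_mem' := ⟨T.domain.zero_mem, by
    have h0 : (⟨0, T.domain.zero_mem⟩ : T.domain) = 0 := rfl
    rw [h0, T.map_zero, smul_zero]⟩
  add_mem' := by
    rintro a b ⟨ha, hTa⟩ ⟨hb, hTb⟩
    refine ⟨T.domain.add_mem ha hb, ?_⟩
    have h : (⟨a + b, T.domain.add_mem ha hb⟩ : T.domain) = ⟨a, ha⟩ + ⟨b, hb⟩ := rfl
    rw [h, T.map_add, hTa, hTb, smul_add]
  smul_mem' := by
    rintro c a ⟨ha, hTa⟩
    refine ⟨T.domain.smul_mem c ha, ?_⟩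
    have h : (⟨c • a, T.domain.smul_mem c ha⟩ : T.domain) = c • (⟨a, ha⟩ : T.domain) := rfl
    rw [h, T.map_smul, hTa, smul_comm]

/-- Orthogonal projection onto a closed submodule, as a map `H →L[ℂ] H`. -/
def projCl (W : Submodule ℂ H) (hW : IsClosed (W : Set H)) : H →L[ℂ] H :=
  letI : CompleteSpace W := hW.completeSpace_coe
  W.subtypeL.comp (Submodule.orthogonalProjectionOnto W)

/-- The boundary map `Γ₁ε⁻ g = P_{ker(T - iε)} (T g + iε g)`. -/
def Gamma1m (T : H →ₗ.[ℂ] H) (hker : ∀ z : ℂ, IsClosed ((pKer T z : Set H)))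
    (ε : ℝ) (g : T.domain) : H :=
  projCl (pKer T ((ε : ℂ) * I)) (hker _) (T g + ((ε : ℂ) * I) • (g : H))

/-- The boundary map `Γ₁ε⁺ g = P_{ker(T + iε)} (T g - iε g)`. -/
def Gamma1p (T : H →ₗ.[ℂ] H) (hker : ∀ z : ℂ, IsClosed ((pKer T z : Set H)))
    (ε : ℝ) (g : T.domain) : H :=
  projCl (pKer T (-((ε : ℂ) * I))) (hker _) (T g - ((ε : ℂ) * I) • (g : H))

/-- The map `Υε g = (2iε)⁻¹ (Γ₁ε⁻ g - Γ₁ε⁺ g)`. -/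
def Ups (T : H →ₗ.[ℂ] H) (hker : ∀ z : ℂ, IsClosed ((pKer T z : Set H)))
    (ε : ℝ) (g : T.domain) : H :=
  (2 * (ε : ℂ) * I)⁻¹ • (Gamma1m T hker ε g - Gamma1p T hker ε g)

/-- For a symmetric operator, `A f` and `i c f` are orthogonal in the real sense, so that
`‖A f‖ ≤ ‖A f + i c f‖` for every real `c`. -/
theorem norm_apply_le_norm_apply_add_imaginary_smul (A : H →ₗ.[ℂ] H)
    (hsym : ∀ f g : A.domain, ⟪(f : H), (A g : H)⟫ = ⟪(A f : H), (g : H)⟫)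
    (c : ℝ) (f : A.domain) : ‖A f‖ ≤ ‖A f + ((c : ℂ) * I) • (f : H)‖ := by
  have him : (⟪(A f : H), (f : H)⟫).im = 0 := by
    have h := inner_conj_symm (𝕜 := ℂ) (A f : H) (f : H)
    rw [hsym f f] at h
    exact Complex.conj_eq_iff_im.mp h
  have hre : RCLike.re ⟪(A f : H), ((c : ℂ) * I) • (f : H)⟫ = 0 := by
    rw [inner_smul_right]
    simp [him]
  have h := norm_add_sq (𝕜 := ℂ) (A f) (((c : ℂ) * I) • (f : H))
  rw [hre] at h
  refine le_of_sq_le_sq ?_ (norm_nonneg _)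
  nlinarith [sq_nonneg ‖((c : ℂ) * I) • (f : H)‖]

/-- A unit vector of the form `A f + i c f` lies within `|c| C` of the range of the symmetric
operator `A`, if `A` is bounded below by `C⁻¹`. -/
theorem infDist_range_le_of_eq_apply_add_imaginary_smul (A : H →ₗ.[ℂ] H)
    (hsym : ∀ f g : A.domain, ⟪(f : H), (A g : H)⟫ = ⟪(A f : H), (g : H)⟫)
    {C : ℝ} (hC : 0 < C) (hbound : ∀ f : A.domain, ‖(f : H)‖ ≤ C * ‖A f‖)
    (c : ℝ) (f : A.domain) {u : H} (hu : ‖u‖ = 1) (hf : A f + ((c : ℂ) * I) • (f : H) = u) :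
    Metric.infDist u {w : H | ∃ f : A.domain, A f = w} ≤ |c| * C := by
  have hA := norm_apply_le_norm_apply_add_imaginary_smul A hsym c f
  rw [hf, hu] at hA
  calc Metric.infDist u {w : H | ∃ f : A.domain, A f = w}
      ≤ dist u (A f) := Metric.infDist_le_dist_of_mem ⟨f, rfl⟩
    _ = |c| * ‖(f : H)‖ := by
      rw [dist_eq_norm, ← hf, add_sub_cancel_left, norm_smul]
      simp
    _ ≤ |c| * C := by
      gcongr
      exact (hbound f).trans (mul_le_of_le_one_right hC.le hA)

theorem statement_0
    (A : H →ₗ.[ℂ] H)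
    (hdense : Dense (A.domain : Set H))
    (hclosed : A.IsClosed)
    (hsym : ∀ f g : A.domain, ⟪(f : H), (A g : H)⟫ = ⟪(A f : H), (g : H)⟫)
    (C : ℝ) (hC : 0 < C)
    (hbound : ∀ f : A.domain, ‖(f : H)‖ ≤ C * ‖A f‖)
    (ε : ℝ) (hε : 0 < ε) :
    (∀ u : H, ‖u‖ = 1 → (∃ f : A.domain, A f - ((ε : ℂ) * I) • (f : H) = u) →
      Metric.infDist u {w : H | ∃ f : A.domain, A f = w} ≤ ε * C) ∧
    (∀ u : H, ‖u‖ = 1 → (∃ f : A.domain, A f + ((ε : ℂ) * I) • (f : H) = u) →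
      Metric.infDist u {w : H | ∃ f : A.domain, A f = w} ≤ ε * C) := by
  refine ⟨?_, ?_⟩
  · rintro u hu ⟨f, hf⟩
    have h := infDist_range_le_of_eq_apply_add_imaginary_smul A hsym hC hbound (-ε) f hu
      (by rw [← hf, ofReal_neg, neg_mul, neg_smul, sub_eq_add_neg])
    rwa [abs_neg, abs_of_pos hε] at h
  · rintro u hu ⟨f, hf⟩
    have h := infDist_range_le_of_eq_apply_add_imaginary_smul A hsym hC hbound ε f hu hf
    rwa [abs_of_pos hε] at h
end
end

section
/- For every ε > 0 and for either choice of sign, the orthogonal projections onto the deficiency subspaces satisfy the operator-norm bound ‖P_{ker(A* ∓ iε)} − P_{ker A*}‖_op ≤ ε·C. -/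
open Complex Filter
open scoped ComplexInnerProductSpace

noncomputable section

variable {H : Type*} [NormedAddCommGroup H] [InnerProductSpace ℂ H] [CompleteSpace H]

/-- Two orthogonal projections are within `c` of each other in operator norm as soon as each
subspace is `c`-almost orthogonal to the orthogonal complement of the other. -/
theorem norm_projCl_sub_projCl_le {U V : Submodule ℂ H} (hU : IsClosed (U : Set H))
    (hV : IsClosed (V : Set H)) {c : ℝ} (hc : 0 ≤ c)
    (hUV : ∀ u ∈ U, ∀ w ∈ Vᗮ, ‖⟪w, u⟫‖ ≤ c * ‖w‖ * ‖u‖)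
    (hVU : ∀ v ∈ V, ∀ w ∈ Uᗮ, ‖⟪w, v⟫‖ ≤ c * ‖w‖ * ‖v‖) :
    ‖projCl U hU - projCl V hV‖ ≤ c := by
  have : CompleteSpace U := hU.completeSpace_coe
  have : CompleteSpace V := hV.completeSpace_coe
  refine ContinuousLinearMap.opNorm_le_bound _ hc fun x => ?_
  have hPU : projCl U hU x = U.starProjection x := rfl
  have hPV : projCl V hV x = V.starProjection x := rfl
  rw [sub_apply, hPU, hPV]
  set p := U.starProjection x with hp
  set r := x - p with hr
  have hpU : p ∈ U := Submodule.starProjection_apply_mem U x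
  have hrU : r ∈ Uᗮ := Submodule.sub_starProjection_mem_orthogonal x
  set q := V.starProjection r with hq
  set s := p - V.starProjection p with hs
  have hqV : q ∈ V := Submodule.starProjection_apply_mem V r
  have hsV : s ∈ Vᗮ := Submodule.sub_starProjection_mem_orthogonal p
  have hsplit : p - V.starProjection x = s - q := by
    have hx : x = p + r := by rw [hr]; abel
    conv_lhs => rw [hx]
    rw [map_add, hs, hq]
    abel
  have hs_le : ‖s‖ ≤ c * ‖p‖ := by
    have hsp : ⟪s, p⟫ = ⟪s, s⟫ := by
      have h0 : ⟪s, V.starProjection p⟫ = 0 :=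
        Submodule.inner_left_of_mem_orthogonal (Submodule.starProjection_apply_mem V p) hsV
      conv_rhs => rw [hs, inner_sub_right, ← hs, h0, sub_zero]
    have h := hUV p hpU s hsV
    rw [hsp, inner_self_eq_norm_sq_to_K, norm_pow, RCLike.norm_ofReal, abs_norm] at h
    by_contra! hlt
    have : 0 < ‖s‖ := lt_of_le_of_lt (by positivity) hlt
    nlinarith
  have hq_le : ‖q‖ ≤ c * ‖r‖ := by
    have hrq : ⟪r, q⟫ = ⟪q, q⟫ := by
      have h0 : ⟪r - q, q⟫ = 0 :=
        Submodule.inner_left_of_mem_orthogonal hqV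
          (Submodule.sub_starProjection_mem_orthogonal r)
      rwa [inner_sub_left, sub_eq_zero] at h0
    have h := hVU q hqV r hrU
    rw [hrq, inner_self_eq_norm_sq_to_K, norm_pow, RCLike.norm_ofReal, abs_norm] at h
    by_contra! hlt
    have : 0 < ‖q‖ := lt_of_le_of_lt (by positivity) hlt
    nlinarith
  have hx_sq : ‖x‖ * ‖x‖ = ‖p‖ * ‖p‖ + ‖r‖ * ‖r‖ := by
    have h0 : ⟪p, r⟫ = 0 := Submodule.inner_right_of_mem_orthogonal hpU hrU
    have h := norm_add_sq_eq_norm_sq_add_norm_sq_of_inner_eq_zero p r h0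
    rwa [hr, add_sub_cancel, ← hr] at h
  have hsq_sq : ‖s - q‖ * ‖s - q‖ = ‖s‖ * ‖s‖ + ‖q‖ * ‖q‖ := by
    have h0 : ⟪s, -q⟫ = 0 := by
      rw [inner_neg_right, Submodule.inner_left_of_mem_orthogonal hqV hsV, neg_zero]
    have h := norm_add_sq_eq_norm_sq_add_norm_sq_of_inner_eq_zero s (-q) h0
    rwa [← sub_eq_add_neg, norm_neg] at h
  rw [hsplit]
  refine le_of_pow_le_pow_left₀ two_ne_zero (by positivity) ?_
  have h1 := mul_self_le_mul_self (norm_nonneg s) hs_le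
  have h2 := mul_self_le_mul_self (norm_nonneg q) hq_le
  linear_combination h1 + h2 + hsq_sq - c ^ 2 * hx_sq

/-- A vector orthogonal to the range of `A - conj z` is an eigenvector of `A†` for `z`. -/
theorem mem_pKer_adjoint_of_forall_inner_eq_zero {A : H →ₗ.[ℂ] H}
    (hdense : Dense (A.domain : Set H)) {z : ℂ} {u : H}
    (hu : ∀ f : A.domain, ⟪A f - (starRingEnd ℂ) z • (f : H), u⟫ = 0) :
    u ∈ pKer A.adjoint z := by
  have hw : ∀ f : A.domain, ⟪z • u, (f : H)⟫ = ⟪u, A f⟫ := fun f => by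
    have h := congrArg (starRingEnd ℂ) (hu f)
    rw [inner_conj_symm, inner_sub_right, inner_smul_right, map_zero, sub_eq_zero] at h
    rw [inner_smul_left, h]
  have hmem := LinearPMap.mem_adjoint_domain_of_exists u ⟨z • u, hw⟩
  exact ⟨hmem, LinearPMap.adjoint_apply_eq hdense ⟨u, hmem⟩ hw⟩

/-- For symmetric `A`, subtracting a purely imaginary multiple of the identity does not
decrease `‖A f‖`. -/
theorem norm_apply_le_norm_sub_smul {A : H →ₗ.[ℂ] H}
    (hsym : ∀ f g : A.domain, ⟪(f : H), (A g : H)⟫ = ⟪(A f : H), (g : H)⟫)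
    {z : ℂ} (hz : z.re = 0) (f : A.domain) : ‖A f‖ ≤ ‖A f - z • (f : H)‖ := by
  have him : (⟪A f, (f : H)⟫).im = 0 := by
    have h := congrArg Complex.im (hsym f f)
    rw [← inner_conj_symm, Complex.conj_im] at h
    linarith
  have hre : RCLike.re ⟪A f, z • (f : H)⟫ = 0 := by
    rw [inner_smul_right]
    change (z * ⟪A f, (f : H)⟫).re = 0
    rw [Complex.mul_re, hz, him]
    ring
  have h := norm_sub_sq (𝕜 := ℂ) (A f) (z • (f : H))
  rw [hre] at h
  refine le_of_pow_le_pow_left₀ two_ne_zero (norm_nonneg _) ?_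
  nlinarith [sq_nonneg ‖z • (f : H)‖]

theorem norm_inner_le_of_mem_pKer_adjoint {A : H →ₗ.[ℂ] H}
    (hdense : Dense (A.domain : Set H))
    (hsym : ∀ f g : A.domain, ⟪(f : H), (A g : H)⟫ = ⟪(A f : H), (g : H)⟫)
    {C : ℝ} (hC : 0 ≤ C) (hbound : ∀ f : A.domain, ‖(f : H)‖ ≤ C * ‖A f‖)
    (a : ℂ) {b : ℂ} (hb : b.re = 0) {u : H} (hu : u ∈ pKer A.adjoint a)
    {w : H} (hw : w ∈ (pKer A.adjoint b)ᗮ) :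
    ‖⟪w, u⟫‖ ≤ ‖a - b‖ * C * ‖w‖ * ‖u‖ := by
  let S : Submodule ℂ H :=
    LinearMap.range (A.toFun - (starRingEnd ℂ) b • A.domain.subtype)
  have hS : ∀ f : A.domain, A f - (starRingEnd ℂ) b • (f : H) ∈ S := fun f => ⟨f, rfl⟩
  have hle : Sᗮ ≤ pKer A.adjoint b := fun v hv =>
    mem_pKer_adjoint_of_forall_inner_eq_zero hdense fun f =>
      Submodule.inner_right_of_mem_orthogonal (hS f) hv
  have hwS : w ∈ S.topologicalClosure := by
    rw [← Submodule.orthogonal_orthogonal_eq_closure]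
    exact Submodule.orthogonal_le hle hw
  have hcl : IsClosed {w : H | ‖⟪w, u⟫‖ ≤ ‖a - b‖ * C * ‖w‖ * ‖u‖} :=
    isClosed_le (by fun_prop) (by fun_prop)
  refine closure_minimal ?_ hcl hwS
  rintro _ ⟨f, rfl⟩
  change ‖⟪A f - (starRingEnd ℂ) b • (f : H), u⟫‖
    ≤ ‖a - b‖ * C * ‖A f - (starRingEnd ℂ) b • (f : H)‖ * ‖u‖
  obtain ⟨hud, hua⟩ := hu
  have hAf : ⟪A f, u⟫ = a * ⟪(f : H), u⟫ := by
    have h := (LinearPMap.adjoint_isFormalAdjoint hdense).symm f ⟨u, hud⟩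
    rw [hua, inner_smul_right] at h
    exact h
  have hinner : ⟪A f - (starRingEnd ℂ) b • (f : H), u⟫ = (a - b) * ⟪(f : H), u⟫ := by
    rw [inner_sub_left, inner_smul_left, hAf, Complex.conj_conj]
    ring
  have hf : ‖(f : H)‖ ≤ C * ‖A f - (starRingEnd ℂ) b • (f : H)‖ :=
    (hbound f).trans (mul_le_mul_of_nonneg_left
      (norm_apply_le_norm_sub_smul hsym (by rwa [Complex.conj_re]) f) hC)
  rw [hinner, norm_mul]
  calc ‖a - b‖ * ‖⟪(f : H), u⟫‖ ≤ ‖a - b‖ * (‖(f : H)‖ * ‖u‖) := by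
        gcongr
        exact norm_inner_le_norm _ _
    _ ≤ ‖a - b‖ * ((C * ‖A f - (starRingEnd ℂ) b • (f : H)‖) * ‖u‖) := by gcongr
    _ = _ := by ring

/-- The projection onto `ker (A† - z)` is Lipschitz in `z` along the imaginary axis. -/
theorem norm_projCl_pKer_adjoint_sub_le {A : H →ₗ.[ℂ] H}
    (hdense : Dense (A.domain : Set H))
    (hsym : ∀ f g : A.domain, ⟪(f : H), (A g : H)⟫ = ⟪(A f : H), (g : H)⟫)
    {C : ℝ} (hC : 0 ≤ C) (hbound : ∀ f : A.domain, ‖(f : H)‖ ≤ C * ‖A f‖)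
    (hker : ∀ z : ℂ, IsClosed ((pKer A.adjoint z : Set H)))
    {a b : ℂ} (ha : a.re = 0) (hb : b.re = 0) :
    ‖projCl (pKer A.adjoint a) (hker a) - projCl (pKer A.adjoint b) (hker b)‖
      ≤ ‖a - b‖ * C := by
  refine norm_projCl_sub_projCl_le (hker a) (hker b) (by positivity)
    (fun u hu w hw => norm_inner_le_of_mem_pKer_adjoint hdense hsym hC hbound a hb hu hw)
    (fun v hv w hw => ?_)
  rw [norm_sub_rev a b]
  exact norm_inner_le_of_mem_pKer_adjoint hdense hsym hC hbound b ha hv hw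

theorem statement_2
    (A : H →ₗ.[ℂ] H)
    (hdense : Dense (A.domain : Set H))
    (hclosed : A.IsClosed)
    (hsym : ∀ f g : A.domain, ⟪(f : H), (A g : H)⟫ = ⟪(A f : H), (g : H)⟫)
    (C : ℝ) (hC : 0 < C)
    (hbound : ∀ f : A.domain, ‖(f : H)‖ ≤ C * ‖A f‖)
    (hker : ∀ z : ℂ, IsClosed ((pKer A.adjoint z : Set H)))
    (ε : ℝ) (hε : 0 < ε) :
    ‖projCl (pKer A.adjoint ((ε : ℂ) * I)) (hker _) - projCl (pKer A.adjoint 0) (hker 0)‖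
      ≤ ε * C ∧
    ‖projCl (pKer A.adjoint (-((ε : ℂ) * I))) (hker _) - projCl (pKer A.adjoint 0) (hker 0)‖
      ≤ ε * C := by
  have hnorm : ‖(ε : ℂ) * I‖ = ε := by
    rw [norm_mul, Complex.norm_I, mul_one, Complex.norm_real, Real.norm_of_nonneg hε.le]
  constructor
  · have h := norm_projCl_pKer_adjoint_sub_le hdense hsym hC.le hbound hker
      (a := (ε : ℂ) * I) (b := 0) (by simp) (by simp)
    rwa [sub_zero, hnorm] at h
  · have h := norm_projCl_pKer_adjoint_sub_le hdense hsym hC.le hbound hker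
      (a := -((ε : ℂ) * I)) (b := 0) (by simp) (by simp)
    rwa [sub_zero, norm_neg, hnorm] at h
end
end

section
/- For every ε > 0 and every g ∈ D(A*) one has ‖A*(Υε g) − P_{ker A*}(A* g)‖ ≤ ε·(‖g‖ + C·‖A* g‖). -/
open Complex Filter
open scoped ComplexInnerProductSpace

noncomputable section

variable {H : Type*} [NormedAddCommGroup H] [InnerProductSpace ℂ H] [CompleteSpace H]

omit [CompleteSpace H] in
/-- If the projection onto `V` is `δ`-small on `Uᗮ`, then the projection onto `Uᗮ` is `δ`-small
on `V`. -/
theorem Submodule.norm_sub_starProjection_le_of_mem {U V : Submodule ℂ H}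
    [U.HasOrthogonalProjection] [V.HasOrthogonalProjection] {δ : ℝ} (hδ : 0 ≤ δ)
    (h : ∀ x ∈ Uᗮ, ‖V.starProjection x‖ ≤ δ * ‖x‖) {y : H} (hy : y ∈ V) :
    ‖y - U.starProjection y‖ ≤ δ * ‖y‖ := by
  set w := y - U.starProjection y with hw
  have hwU : w ∈ Uᗮ := U.sub_starProjection_mem_orthogonal y
  have h1 : inner ℂ w w = inner ℂ (V.starProjection w) y := by
    rw [Submodule.inner_starProjection_left_eq_right, Submodule.starProjection_eq_self_iff.2 hy]
    nth_rewrite 2 [hw]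
    rw [inner_sub_right, Submodule.inner_left_of_mem_orthogonal (U.starProjection_apply_mem y) hwU,
      sub_zero]
  have h2 : ‖w‖ * ‖w‖ ≤ ‖w‖ * (δ * ‖y‖) := by
    calc ‖w‖ * ‖w‖ = ‖(inner ℂ w w : ℂ)‖ := by
          rw [inner_self_eq_norm_sq_to_K]; simp [sq]
      _ ≤ ‖V.starProjection w‖ * ‖y‖ := h1 ▸ norm_inner_le_norm _ _
      _ ≤ δ * ‖w‖ * ‖y‖ := by gcongr; exact h w hwU
      _ = ‖w‖ * (δ * ‖y‖) := by ring
  rcases (norm_nonneg w).eq_or_lt with h0 | h0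
  · rw [← h0]; positivity
  · exact le_of_mul_le_mul_left h2 h0

omit [CompleteSpace H] in
theorem Submodule.norm_starProjection_sub_starProjection_le {U V : Submodule ℂ H}
    [U.HasOrthogonalProjection] [V.HasOrthogonalProjection] {δ : ℝ} (hδ : 0 ≤ δ)
    (hVU : ∀ x ∈ Uᗮ, ‖V.starProjection x‖ ≤ δ * ‖x‖)
    (hUV : ∀ x ∈ Vᗮ, ‖U.starProjection x‖ ≤ δ * ‖x‖) (v : H) :
    ‖U.starProjection v - V.starProjection v‖ ≤ δ * ‖v‖ := by
  have hidem : U.starProjection (U.starProjection v) = U.starProjection v :=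
    Submodule.starProjection_eq_self_iff.2 (U.starProjection_apply_mem v)
  have h1 : ‖U.starProjection (U.starProjection v - V.starProjection v)‖
      ≤ δ * ‖Vᗮ.starProjection v‖ := by
    rw [map_sub, hidem, ← map_sub, Submodule.starProjection_orthogonal_val]
    exact hUV _ (V.sub_starProjection_mem_orthogonal v)
  have h2 : ‖Uᗮ.starProjection (U.starProjection v - V.starProjection v)‖
      ≤ δ * ‖V.starProjection v‖ := by
    rw [Submodule.starProjection_orthogonal_val, map_sub, hidem, sub_sub_sub_cancel_left,
      norm_sub_rev]
    exact Submodule.norm_sub_starProjection_le_of_mem hδ hVU (V.starProjection_apply_mem v)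
  refine le_of_sq_le_sq ?_ (by positivity)
  rw [Submodule.norm_sq_eq_add_norm_sq_starProjection _ U, mul_pow,
    Submodule.norm_sq_eq_add_norm_sq_starProjection v V]
  calc _ ≤ (δ * ‖Vᗮ.starProjection v‖) ^ 2 + (δ * ‖V.starProjection v‖) ^ 2 := by gcongr
    _ = _ := by ring

theorem projCl_eq_starProjection (W : Submodule ℂ H) (hW : IsClosed (W : Set H))
    [W.HasOrthogonalProjection] (v : H) : projCl W hW v = W.starProjection v :=
  rfl

theorem projCl_mem (W : Submodule ℂ H) (hW : IsClosed (W : Set H)) (v : H) : projCl W hW v ∈ W := by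
  have : CompleteSpace W := hW.completeSpace_coe
  exact W.starProjection_apply_mem v

theorem norm_projCl_le (W : Submodule ℂ H) (hW : IsClosed (W : Set H)) (v : H) :
    ‖projCl W hW v‖ ≤ ‖v‖ := by
  have : CompleteSpace W := hW.completeSpace_coe
  exact W.norm_starProjection_apply_le v

/-- The range of `A - c` on the domain of `A`. -/
def shiftRange (A : H →ₗ.[ℂ] H) (c : ℂ) : Submodule ℂ H :=
  LinearMap.range (A.toFun - c • A.domain.subtype)

omit [CompleteSpace H] in
theorem mem_shiftRange {A : H →ₗ.[ℂ] H} {c : ℂ} {x : H} :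
    x ∈ shiftRange A c ↔ ∃ f : A.domain, A f - c • (f : H) = x :=
  Iff.rfl

theorem pKer_adjoint_eq {A : H →ₗ.[ℂ] H} (hdense : Dense (A.domain : Set H)) (z : ℂ) :
    pKer A.adjoint z = (shiftRange A (starRingEnd ℂ z))ᗮ := by
  ext u
  rw [Submodule.mem_orthogonal']
  constructor
  · rintro ⟨hu, hz⟩ x hx
    obtain ⟨f, rfl⟩ := mem_shiftRange.1 hx
    have h := LinearPMap.adjoint_isFormalAdjoint hdense ⟨u, hu⟩ f
    rw [hz, inner_smul_left] at h
    rw [inner_sub_right, inner_smul_right, ← h, sub_self]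
  · intro h
    have key : ∀ f : A.domain, inner ℂ (z • u) (f : H) = inner ℂ u (A f) := by
      intro f
      have hf := h _ (mem_shiftRange.2 ⟨f, rfl⟩)
      rw [inner_sub_right, inner_smul_right, sub_eq_zero] at hf
      rw [inner_smul_left, hf]
    have hu : u ∈ A.adjoint.domain := LinearPMap.mem_adjoint_domain_of_exists u ⟨_, key⟩
    exact ⟨hu, LinearPMap.adjoint_apply_eq hdense ⟨u, hu⟩ key⟩

omit [CompleteSpace H] in
theorem norm_apply_le_norm_apply_sub_smul {A : H →ₗ.[ℂ] H}
    (hsym : ∀ f g : A.domain, ⟪(f : H), (A g : H)⟫ = ⟪(A f : H), (g : H)⟫)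
    {c : ℂ} (hc : c.re = 0) (f : A.domain) : ‖A f‖ ≤ ‖A f - c • (f : H)‖ := by
  have him : (inner ℂ (A f) (f : H) : ℂ).im = 0 := by
    rw [← Complex.conj_eq_iff_im, inner_conj_symm, hsym]
  have hre : RCLike.re (inner ℂ (A f) (c • (f : H)) : ℂ) = 0 := by
    rw [inner_smul_right]
    simp [hc, him]
  refine le_of_sq_le_sq ?_ (norm_nonneg _)
  rw [@norm_sub_sq ℂ, hre]
  nlinarith [sq_nonneg ‖c • (f : H)‖]

theorem norm_starProjection_pKer_le {A : H →ₗ.[ℂ] H} (hdense : Dense (A.domain : Set H))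
    (hsym : ∀ f g : A.domain, ⟪(f : H), (A g : H)⟫ = ⟪(A f : H), (g : H)⟫)
    {C : ℝ} (hC : 0 ≤ C) (hbound : ∀ f : A.domain, ‖(f : H)‖ ≤ C * ‖A f‖)
    {z w : ℂ} (hz : z.re = 0) [(pKer A.adjoint w).HasOrthogonalProjection]
    {x : H} (hx : x ∈ (pKer A.adjoint z)ᗮ) :
    ‖(pKer A.adjoint w).starProjection x‖ ≤ ‖z - w‖ * C * ‖x‖ := by
  rw [pKer_adjoint_eq hdense z, Submodule.orthogonal_orthogonal_eq_closure] at hx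
  have hcl : IsClosed {x : H | ‖(pKer A.adjoint w).starProjection x‖ ≤ ‖z - w‖ * C * ‖x‖} :=
    isClosed_le (by fun_prop) (by fun_prop)
  refine closure_minimal ?_ hcl hx
  intro y hy
  obtain ⟨f, rfl⟩ := mem_shiftRange.1 hy
  set cz := starRingEnd ℂ z
  set cw := starRingEnd ℂ w
  have h0 : (pKer A.adjoint w).starProjection (A f - cw • (f : H)) = 0 := by
    rw [Submodule.starProjection_apply_eq_zero_iff, pKer_adjoint_eq hdense w]
    exact Submodule.le_orthogonal_orthogonal _ (mem_shiftRange.2 ⟨f, rfl⟩)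
  have hsplit : A f - cz • (f : H) = (A f - cw • (f : H)) - (cz - cw) • (f : H) := by
    rw [sub_smul]; abel
  have hnorm : ‖cz - cw‖ = ‖z - w‖ := by
    rw [← map_sub, RCLike.norm_conj]
  calc ‖(pKer A.adjoint w).starProjection (A f - cz • (f : H))‖
      = ‖(pKer A.adjoint w).starProjection ((cz - cw) • (f : H))‖ := by
        rw [hsplit, map_sub, h0, zero_sub, norm_neg]
    _ ≤ ‖(cz - cw) • (f : H)‖ := Submodule.norm_starProjection_apply_le _ _
    _ = ‖z - w‖ * ‖(f : H)‖ := by rw [norm_smul, hnorm]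
    _ ≤ ‖z - w‖ * (C * ‖A f - cz • (f : H)‖) := by
        gcongr
        refine (hbound f).trans ?_
        gcongr
        exact norm_apply_le_norm_apply_sub_smul hsym (by simp [cz, hz]) f
    _ = ‖z - w‖ * C * ‖A f - cz • (f : H)‖ := by ring

theorem norm_projCl_pKer_sub_le {A : H →ₗ.[ℂ] H} (hdense : Dense (A.domain : Set H))
    (hsym : ∀ f g : A.domain, ⟪(f : H), (A g : H)⟫ = ⟪(A f : H), (g : H)⟫)
    {C : ℝ} (hC : 0 ≤ C) (hbound : ∀ f : A.domain, ‖(f : H)‖ ≤ C * ‖A f‖)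
    (hker : ∀ z : ℂ, IsClosed ((pKer A.adjoint z : Set H)))
    {z w : ℂ} (hz : z.re = 0) (hw : w.re = 0) (v : H) :
    ‖projCl (pKer A.adjoint z) (hker z) v - projCl (pKer A.adjoint w) (hker w) v‖
      ≤ ‖z - w‖ * C * ‖v‖ := by
  have : CompleteSpace (pKer A.adjoint z) := (hker z).completeSpace_coe
  have : CompleteSpace (pKer A.adjoint w) := (hker w).completeSpace_coe
  rw [projCl_eq_starProjection, projCl_eq_starProjection]
  refine Submodule.norm_starProjection_sub_starProjection_le (by positivity)
    (fun x hx => norm_starProjection_pKer_le hdense hsym hC hbound hz hx) (fun x hx => ?_) v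
  rw [norm_sub_rev z w]
  exact norm_starProjection_pKer_le hdense hsym hC hbound hw hx

theorem apply_Ups (T : H →ₗ.[ℂ] H) (hker : ∀ z : ℂ, IsClosed ((pKer T z : Set H)))
    {ε : ℝ} (hε : ε ≠ 0) (g : T.domain) (hm : Ups T hker ε g ∈ T.domain) :
    T ⟨Ups T hker ε g, hm⟩ = (2 : ℂ)⁻¹ • (Gamma1m T hker ε g + Gamma1p T hker ε g) := by
  obtain ⟨h1, e1⟩ : Gamma1m T hker ε g ∈ pKer T (ε * I) := projCl_mem _ _ _
  obtain ⟨h2, e2⟩ : Gamma1p T hker ε g ∈ pKer T (-(ε * I)) := projCl_mem _ _ _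
  have h : (⟨Ups T hker ε g, hm⟩ : T.domain)
      = (2 * (ε : ℂ) * I)⁻¹ • (⟨Gamma1m T hker ε g, h1⟩ - ⟨Gamma1p T hker ε g, h2⟩) := rfl
  have hε' : (ε : ℂ) ≠ 0 := by exact_mod_cast hε
  have hs : (2 * (ε : ℂ) * I)⁻¹ * (ε * I) = 2⁻¹ := by
    field_simp
  rw [h, T.map_smul, T.map_sub, e1, e2, neg_smul, sub_neg_eq_add, ← smul_add, smul_smul, hs]

theorem statement_7
    (A : H →ₗ.[ℂ] H)
    (hdense : Dense (A.domain : Set H))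
    (hclosed : A.IsClosed)
    (hsym : ∀ f g : A.domain, ⟪(f : H), (A g : H)⟫ = ⟪(A f : H), (g : H)⟫)
    (C : ℝ) (hC : 0 < C)
    (hbound : ∀ f : A.domain, ‖(f : H)‖ ≤ C * ‖A f‖)
    (hker : ∀ z : ℂ, IsClosed ((pKer A.adjoint z : Set H)))
    (ε : ℝ) (hε : 0 < ε) (g : A.adjoint.domain)
    (hm : Ups A.adjoint hker ε g ∈ A.adjoint.domain) :
    ‖A.adjoint ⟨Ups A.adjoint hker ε g, hm⟩
        - projCl (pKer A.adjoint 0) (hker 0) (A.adjoint g)‖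
      ≤ ε * (‖(g : H)‖ + C * ‖A.adjoint g‖) := by
  rw [apply_Ups A.adjoint hker hε.ne' g hm, Gamma1m, Gamma1p]
  set a : ℂ := (ε : ℂ) * I with ha
  set v := A.adjoint g
  have hare : a.re = 0 := by simp [ha]
  have hna : ‖a‖ = ε := by simp [ha, abs_of_pos hε]
  have hp := norm_projCl_pKer_sub_le hdense hsym hC.le hbound hker hare Complex.zero_re v
  have hn := norm_projCl_pKer_sub_le hdense hsym hC.le hbound hker
    (z := -a) (by simp [hare]) Complex.zero_re v
  rw [sub_zero, hna] at hp
  rw [sub_zero, norm_neg, hna] at hn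
  have hgp := norm_projCl_le _ (hker a) (g : H)
  have hgn := norm_projCl_le _ (hker (-a)) (g : H)
  rw [map_add, map_sub, map_smul, map_smul]
  set P := projCl _ (hker a)
  set N := projCl _ (hker (-a))
  set Z := projCl _ (hker 0)
  have hsplit : (2 : ℂ)⁻¹ • (P v + a • P g + (N v - a • N g)) - Z v
      = (2 : ℂ)⁻¹ • ((P v - Z v) + (N v - Z v) + a • (P g - N g)) := by
    module
  have hsum : ‖(P v - Z v) + (N v - Z v) + a • (P g - N g)‖
      ≤ ε * C * ‖v‖ + ε * C * ‖v‖ + ε * (‖(g : H)‖ + ‖(g : H)‖) := by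
    refine (norm_add₃_le).trans ?_
    rw [norm_smul, hna]
    gcongr
    exact (norm_sub_le _ _).trans (add_le_add hgp hgn)
  rw [hsplit, norm_smul, norm_inv, Complex.norm_ofNat]
  linarith
end
end

section
/- Suppose g ∈ D(A*) decomposes as g = f + B u₁ + u₀ with f ∈ D(A) and u₀, u₁ ∈ ker A*. Then u₀ = g − B(A* g), u₁ = P_{ker A*}(A* g), and f = B(A* g − P_{ker A*}(A* g)). -/
open Complex Filter
open scoped ComplexInnerProductSpace

noncomputable section

variable {H : Type*} [NormedAddCommGroup H] [InnerProductSpace ℂ H] [CompleteSpace H]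

theorem inner_eq_zero_of_mem_pKer_adjoint {A : H →ₗ.[ℂ] H} (hA : Dense (A.domain : Set H))
    {u : H} (hu : u ∈ pKer A.adjoint 0) (x : A.domain) : ⟪u, A x⟫ = 0 := by
  obtain ⟨hu, hAu⟩ := hu
  rw [← LinearPMap.adjoint_isFormalAdjoint hA ⟨u, hu⟩ x, hAu, zero_smul, inner_zero_left]

/-- `projCl W` fixes the `W`-component and kills the orthogonal component. -/
theorem projCl_add_eq_right {W : Submodule ℂ H} (hW : IsClosed (W : Set H)) {v w : H}
    (hv : v ∈ Wᗮ) (hw : w ∈ W) : projCl W hW (v + w) = w := by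
  have : CompleteSpace W := hW.completeSpace_coe
  change W.starProjection (v + w) = w
  rw [map_add, (Submodule.starProjection_apply_eq_zero_iff W).2 hv, zero_add,
    Submodule.starProjection_eq_self_iff.2 hw]

theorem statement_10
    (A : H →ₗ.[ℂ] H)
    (hdense : Dense (A.domain : Set H))
    (hclosed : A.IsClosed)
    (hsym : ∀ f g : A.domain, ⟪(f : H), (A g : H)⟫ = ⟪(A f : H), (g : H)⟫)
    (hker : ∀ z : ℂ, IsClosed ((pKer A.adjoint z : Set H)))
    (SD : H →ₗ.[ℂ] H) (hSDsa : SD.adjoint = SD) (hASD : A ≤ SD)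
    (B : H →L[ℂ] H) (b : ℝ) (hb : ‖B‖ = b)
    (hB1 : ∀ x : SD.domain, B (SD x) = x)
    (hB2 : ∀ y : H, ∃ hy : B y ∈ SD.domain, SD ⟨B y, hy⟩ = y)
    (g : A.adjoint.domain) (f : A.domain) (u₀ u₁ : H)
    (hu₀ : u₀ ∈ pKer A.adjoint 0) (hu₁ : u₁ ∈ pKer A.adjoint 0)
    (hg : (g : H) = (f : H) + B u₁ + u₀) :
    u₀ = (g : H) - B (A.adjoint g) ∧
    u₁ = projCl (pKer A.adjoint 0) (hker 0) (A.adjoint g) ∧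
    (f : H) = B (A.adjoint g - projCl (pKer A.adjoint 0) (hker 0) (A.adjoint g)) := by
  have hfA : B (A f) = f := by
    rw [hASD.2 (x := f) (y := ⟨f, hASD.1 f.2⟩) rfl, hB1]
  have hSD : SD.IsFormalAdjoint SD := by
    have h := LinearPMap.adjoint_isFormalAdjoint (hdense.mono hASD.1 : Dense (SD.domain : Set H))
    rwa [hSDsa] at h
  have hAg : A.adjoint g = A f + u₁ := by
    refine LinearPMap.adjoint_apply_eq hdense g fun x => ?_
    obtain ⟨hy, hSDy⟩ := hB2 u₁
    have hu₁x : ⟪B u₁, A x⟫ = ⟪u₁, (x : H)⟫ := by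
      rw [hASD.2 (x := x) (y := ⟨x, hASD.1 x.2⟩) rfl, ← hSD ⟨B u₁, hy⟩ ⟨x, hASD.1 x.2⟩, hSDy]
    rw [hg, inner_add_left, inner_add_left, inner_add_left, hsym, hu₁x,
      inner_eq_zero_of_mem_pKer_adjoint hdense hu₀, add_zero]
  have hproj : projCl (pKer A.adjoint 0) (hker 0) (A.adjoint g) = u₁ := by
    rw [hAg]
    refine projCl_add_eq_right _ ?_ hu₁
    exact (Submodule.mem_orthogonal _ _).2 fun u hu =>
      inner_eq_zero_of_mem_pKer_adjoint hdense hu f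
  refine ⟨?_, hproj.symm, ?_⟩
  · rw [hAg, map_add, hfA, hg, add_sub_cancel_left]
  · rw [hproj, hAg, add_sub_cancel_right, hfA]
end
end

section
/- Let ε > 0 and suppose g ∈ D(A*) decomposes both as g = f_ε + u_ε − v_ε with f_ε ∈ D(A), u_ε ∈ ker(A* − iε), v_ε ∈ ker(A* + iε), and as g = f + B u₁ + u₀ with f ∈ D(A), u₀, u₁ ∈ ker A*. Then ‖A f_ε − A f‖ ≤ ε·(‖g‖ + C·‖A* g‖) and ‖f_ε − f‖ ≤ ε·C·(‖g‖ + C·‖A* g‖). -/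
open Complex Filter
open scoped ComplexInnerProductSpace

noncomputable section

variable {H : Type*} [NormedAddCommGroup H] [InnerProductSpace ℂ H] [CompleteSpace H]

/-- For a densely defined `A`, elements of `ker (A* - z)` are weak eigenvectors of `A`. -/
theorem inner_map_of_mem_pKer_adjoint {A : H →ₗ.[ℂ] H} (hdense : Dense (A.domain : Set H))
    {z : ℂ} {u : H} (hu : u ∈ pKer A.adjoint z) (x : A.domain) : ⟪u, A x⟫ = ⟪z • u, (x : H)⟫ := by
  obtain ⟨hu, h⟩ := hu
  rw [← h]
  exact (A.adjoint_isFormalAdjoint hdense ⟨u, hu⟩ x).symm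

/-- A right inverse of a self-adjoint extension of `A` is a weak right inverse of `A*`. -/
theorem inner_map_of_selfAdjoint_extension {A S : H →ₗ.[ℂ] H}
    (hdense : Dense (A.domain : Set H)) (hS : S.adjoint = S) (hAS : A ≤ S)
    (y : S.domain) (x : A.domain) : ⟪(y : H), A x⟫ = ⟪S y, (x : H)⟫ := by
  have hform : S.IsFormalAdjoint S := by
    have h := S.adjoint_isFormalAdjoint (hdense.mono hAS.1)
    rwa [hS] at h
  have h := hform y ⟨x, hAS.1 x.2⟩
  rw [h, hAS.2 (x := x) (y := ⟨x, hAS.1 x.2⟩) rfl]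

theorem statement_11
    (A : H →ₗ.[ℂ] H)
    (hdense : Dense (A.domain : Set H))
    (hclosed : A.IsClosed)
    (hsym : ∀ f g : A.domain, ⟪(f : H), (A g : H)⟫ = ⟪(A f : H), (g : H)⟫)
    (C : ℝ) (hC : 0 < C)
    (hbound : ∀ f : A.domain, ‖(f : H)‖ ≤ C * ‖A f‖)
    (hker : ∀ z : ℂ, IsClosed ((pKer A.adjoint z : Set H)))
    (SD : H →ₗ.[ℂ] H) (hSDsa : SD.adjoint = SD) (hASD : A ≤ SD)
    (B : H →L[ℂ] H) (b : ℝ) (hb : ‖B‖ = b)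
    (hB1 : ∀ x : SD.domain, B (SD x) = x)
    (hB2 : ∀ y : H, ∃ hy : B y ∈ SD.domain, SD ⟨B y, hy⟩ = y)
    (ε : ℝ) (hε : 0 < ε) (g : A.adjoint.domain)
    (fε : A.domain) (uε vε : H)
    (huε : uε ∈ pKer A.adjoint ((ε : ℂ) * I))
    (hvε : vε ∈ pKer A.adjoint (-((ε : ℂ) * I)))
    (hgε : (g : H) = (fε : H) + uε - vε)
    (f : A.domain) (u₀ u₁ : H)
    (hu₀ : u₀ ∈ pKer A.adjoint 0) (hu₁ : u₁ ∈ pKer A.adjoint 0)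
    (hg : (g : H) = (f : H) + B u₁ + u₀) :
    ‖A fε - A f‖ ≤ ε * (‖(g : H)‖ + C * ‖A.adjoint g‖) ∧
    ‖(fε : H) - (f : H)‖ ≤ ε * C * (‖(g : H)‖ + C * ‖A.adjoint g‖) := by
  have hSD (x : A.domain) : ⟪B u₁, A x⟫ = ⟪u₁, (x : H)⟫ := by
    obtain ⟨hy, hSy⟩ := hB2 u₁
    simpa only [hSy] using inner_map_of_selfAdjoint_extension hdense hSDsa hASD ⟨B u₁, hy⟩ x
  have hker₁ (x : A.domain) : ⟪u₁, A x⟫ = 0 := by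
    simpa using inner_map_of_mem_pKer_adjoint hdense hu₁ x
  have hadj : A.adjoint g = A f + u₁ := A.adjoint_apply_eq hdense g fun x => by
    rw [hg, inner_add_left, inner_add_left, inner_add_left, hsym, hSD,
      inner_map_of_mem_pKer_adjoint hdense hu₀]
    simp
  have hadjε : A.adjoint g = A fε + ((ε : ℂ) * I) • (uε + vε) :=
    A.adjoint_apply_eq hdense g fun x => by
      rw [hgε, inner_sub_left, inner_add_left, inner_add_left, hsym,
        inner_map_of_mem_pKer_adjoint hdense huε, inner_map_of_mem_pKer_adjoint hdense hvε]
      simp only [neg_smul, smul_add, inner_add_left, inner_neg_left]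
      ring
  have hf : ‖(f : H)‖ ≤ C * ‖A.adjoint g‖ := by
    refine (hbound f).trans (mul_le_mul_of_nonneg_left ?_ hC.le)
    have h := norm_add_sq_eq_norm_sq_add_norm_sq_of_inner_eq_zero (𝕜 := ℂ) (A f) u₁
      (inner_eq_zero_symm.mp (hker₁ f))
    rw [hadj]
    nlinarith [norm_nonneg (A f + u₁), norm_nonneg (A f), norm_nonneg u₁]
  set M := ‖(g : H)‖ + C * ‖A.adjoint g‖
  set h : A.domain := fε - f with hh
  have hAh : A h = u₁ - ((ε : ℂ) * I) • (uε + vε) := by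
    rw [hh, A.map_sub, sub_eq_sub_iff_add_eq_add, add_comm u₁, ← hadj, hadjε]
  have hinner : ⟪A h, A h⟫ = (ε : ℂ) ^ 2 * ⟪(g : H) - f - h, (h : H)⟫ := by
    have hgh : (g : H) - f - h = uε - vε := by
      rw [hh, hgε, AddSubgroupClass.coe_sub]
      abel
    rw [hgh]
    nth_rewrite 1 [hAh]
    rw [inner_sub_left, hker₁, inner_smul_left, inner_add_left,
      inner_map_of_mem_pKer_adjoint hdense huε, inner_map_of_mem_pKer_adjoint hdense hvε]
    simp only [inner_smul_left, inner_sub_left, map_mul, map_neg, conj_ofReal, conj_I]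
    linear_combination (-(ε : ℂ) ^ 2 * (⟪uε, (h : H)⟫ - ⟪vε, (h : H)⟫)) * I_sq
  have hnorm : ‖A h‖ ^ 2 + ε ^ 2 * ‖(h : H)‖ ^ 2 ≤ ε ^ 2 * (M * ‖(h : H)‖) := by
    have hsq : ‖A h‖ ^ 2 + ε ^ 2 * ‖(h : H)‖ ^ 2 = ε ^ 2 * (⟪(g : H) - f, (h : H)⟫).re := by
      have hself (x : H) : (⟪x, x⟫).re = ‖x‖ ^ 2 := inner_self_eq_norm_sq (𝕜 := ℂ) x
      have hre := congrArg re hinner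
      rw [← ofReal_pow, re_ofReal_mul, inner_sub_left, sub_re, hself, hself] at hre
      linarith
    rw [hsq]
    refine mul_le_mul_of_nonneg_left ?_ (sq_nonneg ε)
    calc (⟪(g : H) - f, (h : H)⟫).re ≤ ‖(g : H) - f‖ * ‖(h : H)‖ := re_inner_le_norm (𝕜 := ℂ) _ _
      _ ≤ M * ‖(h : H)‖ := by
        gcongr
        exact (norm_sub_le _ _).trans (by linarith)
  have hM0 : 0 ≤ M := by positivity
  have hAhM : ‖A h‖ ≤ ε * M := by
    have hhM : ‖(h : H)‖ ≤ M := by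
      by_contra! hlt
      have : 0 < ε ^ 2 * (‖(h : H)‖ * (‖(h : H)‖ - M)) :=
        mul_pos (pow_pos hε 2) (mul_pos (hM0.trans_lt hlt) (sub_pos.mpr hlt))
      nlinarith [sq_nonneg ‖A h‖]
    refine (abs_le_of_sq_le_sq' ?_ (by positivity)).2
    nlinarith [mul_le_mul_of_nonneg_left (mul_le_mul_of_nonneg_left hhM hM0) (sq_nonneg ε),
      mul_nonneg (sq_nonneg ε) (sq_nonneg ‖(h : H)‖)]
  rw [← A.map_sub, ← AddSubgroupClass.coe_sub]
  refine ⟨hAhM, (hbound h).trans ?_⟩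
  calc C * ‖A h‖ ≤ C * (ε * M) := by gcongr
    _ = ε * C * M := by ring
end
end

section
/- Let ε > 0 and suppose g ∈ D(A*) decomposes both as g = f_ε + u_ε − v_ε with f_ε ∈ D(A), u_ε ∈ ker(A* − iε), v_ε ∈ ker(A* + iε), and as g = f + B u₁ + u₀ with f ∈ D(A), u₀, u₁ ∈ ker A*. Then ‖(u_ε − v_ε) − (B u₁ + u₀)‖ ≤ ε·C·(‖g‖ + C·‖A* g‖). -/
open Complex Filter
open scoped ComplexInnerProductSpace

noncomputable section

variable {H : Type*} [NormedAddCommGroup H] [InnerProductSpace ℂ H] [CompleteSpace H]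

/-- Elements of `ker (A† - z)` pair with the range of `A` as eigenvectors. -/
theorem inner_apply_of_mem_pKer_adjoint {A : H →ₗ.[ℂ] H} (hdense : Dense (A.domain : Set H))
    {z : ℂ} {u : H} (hu : u ∈ pKer A.adjoint z) (h : A.domain) :
    ⟪u, A h⟫ = ⟪z • u, (h : H)⟫ := by
  obtain ⟨hu, hAu⟩ := hu
  rw [← hAu]
  exact (A.adjoint_isFormalAdjoint hdense ⟨u, hu⟩ h).symm

/-- If `q` pairs with `A x` as `iε p` pairs with `x`, then `(p, iε q)` is orthogonal to `(x, A x)`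
in the `ε`-weighted graph inner product, so it is dominated by their sum. -/
theorem weighted_graph_norm_le {E : Type*} [NormedAddCommGroup E] [InnerProductSpace ℂ E]
    {A : E →ₗ.[ℂ] E} {ε : ℝ} {p q : E} (x : A.domain)
    (hq : ⟪q, A x⟫ = ⟪((ε : ℂ) * I) • p, (x : E)⟫) :
    ε ^ 2 * ‖p‖ ^ 2 + ε ^ 2 * ‖q‖ ^ 2 ≤
      ε ^ 2 * ‖(x : E) + p‖ ^ 2 + ‖A x + ((ε : ℂ) * I) • q‖ ^ 2 := by
  have hcross : (⟪A x, ((ε : ℂ) * I) • q⟫).re = -ε ^ 2 * (⟪(x : E), p⟫).re := by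
    have hq' : ⟪A x, q⟫ = ((ε : ℂ) * I) * ⟪(x : E), p⟫ := by
      rw [← inner_conj_symm, hq, inner_conj_symm, inner_smul_right]
    rw [inner_smul_right, hq', ← mul_assoc,
      show (ε : ℂ) * I * (ε * I) = ((-ε ^ 2 : ℝ) : ℂ) by
        push_cast; linear_combination (ε : ℂ) ^ 2 * I_mul_I, re_ofReal_mul]
  have h₁ := norm_add_sq (𝕜 := ℂ) (x : E) p
  have h₂ := norm_add_sq (𝕜 := ℂ) (A x) (((ε : ℂ) * I) • q)
  have hn : ‖((ε : ℂ) * I) • q‖ ^ 2 = ε ^ 2 * ‖q‖ ^ 2 := by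
    simp [norm_smul, mul_pow]
  simp only [RCLike.re_to_complex] at h₁ h₂
  rw [h₁, h₂, hcross, hn]
  nlinarith [sq_nonneg (ε * ‖(x : E)‖), sq_nonneg ‖A x‖]

/-- The range of a symmetric operator is orthogonal to the kernel of its adjoint, so `‖A d‖` is
controlled by `q` whenever `A d = iε q - w` with `w` in that kernel. -/
theorem norm_apply_sq_le {E : Type*} [NormedAddCommGroup E] [InnerProductSpace ℂ E]
    {A : E →ₗ.[ℂ] E} {ε : ℝ} (hε : 0 ≤ ε) {q w : E} (d : A.domain)
    (hd : A d = ((ε : ℂ) * I) • q - w) (hw : ⟪w, A d⟫ = 0) :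
    ‖A d‖ ^ 2 ≤ ε * ‖⟪q, A d⟫‖ := by
  have h : ⟪A d, A d⟫ = ⟪((ε : ℂ) * I) • q, A d⟫ := by
    nth_rewrite 1 [hd]
    rw [inner_sub_left, hw, sub_zero]
  have h' := congrArg norm h
  rw [inner_smul_left, norm_mul, inner_self_eq_norm_sq_to_K] at h'
  simp [abs_of_nonneg hε] at h'
  exact h'.le

theorem le_of_mul_self_le_mul_nonneg {s t : ℝ} (hs : 0 ≤ s) (ht : 0 ≤ t) (h : s * s ≤ s * t) :
    s ≤ t := by
  rcases hs.eq_or_lt with rfl | hs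
  · exact ht
  · exact le_of_mul_le_mul_left h hs

theorem statement_12
    (A : H →ₗ.[ℂ] H)
    (hdense : Dense (A.domain : Set H))
    (hclosed : A.IsClosed)
    (hsym : ∀ f g : A.domain, ⟪(f : H), (A g : H)⟫ = ⟪(A f : H), (g : H)⟫)
    (C : ℝ) (hC : 0 < C)
    (hbound : ∀ f : A.domain, ‖(f : H)‖ ≤ C * ‖A f‖)
    (hker : ∀ z : ℂ, IsClosed ((pKer A.adjoint z : Set H)))
    (SD : H →ₗ.[ℂ] H) (hSDsa : SD.adjoint = SD) (hASD : A ≤ SD)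
    (B : H →L[ℂ] H) (b : ℝ) (hb : ‖B‖ = b)
    (hB1 : ∀ x : SD.domain, B (SD x) = x)
    (hB2 : ∀ y : H, ∃ hy : B y ∈ SD.domain, SD ⟨B y, hy⟩ = y)
    (ε : ℝ) (hε : 0 < ε) (g : A.adjoint.domain)
    (fε : A.domain) (uε vε : H)
    (huε : uε ∈ pKer A.adjoint ((ε : ℂ) * I))
    (hvε : vε ∈ pKer A.adjoint (-((ε : ℂ) * I)))
    (hgε : (g : H) = (fε : H) + uε - vε)
    (f : A.domain) (u₀ u₁ : H)
    (hu₀ : u₀ ∈ pKer A.adjoint 0) (hu₁ : u₁ ∈ pKer A.adjoint 0)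
    (hg : (g : H) = (f : H) + B u₁ + u₀) :
    ‖(uε - vε) - (B u₁ + u₀)‖ ≤ ε * C * (‖(g : H)‖ + C * ‖A.adjoint g‖) := by
  set a : ℂ := (ε : ℂ) * I with ha
  have hna : ‖a‖ = ε := by simp [ha, abs_of_pos hε]
  have hsub (h : A.domain) : ⟪uε - vε, A h⟫ = ⟪a • (uε + vε), (h : H)⟫ := by
    rw [inner_sub_left, inner_apply_of_mem_pKer_adjoint hdense huε,
      inner_apply_of_mem_pKer_adjoint hdense hvε, ← inner_sub_left]
    congr 1; module
  have hadd (h : A.domain) : ⟪uε + vε, A h⟫ = ⟪a • (uε - vε), (h : H)⟫ := by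
    rw [inner_add_left, inner_apply_of_mem_pKer_adjoint hdense huε,
      inner_apply_of_mem_pKer_adjoint hdense hvε, ← inner_add_left]
    congr 1; module
  have hgA : A.adjoint g = A f + u₁ := by
    refine A.adjoint_apply_eq hdense g fun h => ?_
    have hSDdense : Dense (SD.domain : Set H) := hdense.mono hASD.1
    obtain ⟨hy, hBy⟩ := hB2 u₁
    have hSDh : A h = SD ⟨h, hASD.1 h.2⟩ := hASD.2 rfl
    have hBu : ⟪B u₁, A h⟫ = ⟪u₁, (h : H)⟫ := by
      have hformal := SD.adjoint_isFormalAdjoint hSDdense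
      rw [hSDsa] at hformal
      rw [hSDh, ← hformal ⟨B u₁, hy⟩ ⟨h, hASD.1 h.2⟩, hBy]
    rw [hg, inner_add_left, inner_add_left, inner_add_left, hsym, hBu,
      inner_apply_of_mem_pKer_adjoint hdense hu₀, zero_smul, inner_zero_left, add_zero]
  have hgAε : A.adjoint g = A fε + a • (uε + vε) := by
    refine A.adjoint_apply_eq hdense g fun h => ?_
    rw [hgε, add_sub_assoc, inner_add_left, inner_add_left, hsym, hsub]
  have hdd : (uε - vε) - (B u₁ + u₀) = ((f - fε : A.domain) : H) := by
    have h := hg.symm.trans hgε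
    push_cast
    linear_combination (norm := module) h.symm
  have hAd : A (f - fε) = a • (uε + vε) - u₁ := by
    rw [A.map_sub]
    linear_combination (norm := module) hgA.symm.trans hgAε
  rw [hdd]
  generalize f - fε = d at hAd
  have hsq := norm_apply_sq_le hε.le d hAd (by
    rw [inner_apply_of_mem_pKer_adjoint hdense hu₁, zero_smul, inner_zero_left])
  have hgraph := weighted_graph_norm_le fε (hadd fε)
  rw [← ha, ← hgAε, ← add_sub_assoc, ← hgε] at hgraph
  have hweighted : ε ^ 2 * ‖(g : H)‖ ^ 2 + ‖A.adjoint g‖ ^ 2 ≤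
      (ε * ‖(g : H)‖ + ‖A.adjoint g‖) ^ 2 := by
    nlinarith [mul_nonneg (mul_nonneg hε.le (norm_nonneg (g : H))) (norm_nonneg (A.adjoint g))]
  have hp : ε * ‖uε - vε‖ ≤ ε * ‖(g : H)‖ + ‖A.adjoint g‖ := by
    refine (sq_le_sq₀ (by positivity) (by positivity)).1 ?_
    nlinarith [sq_nonneg (ε * ‖uε + vε‖)]
  have hq : ε * ‖uε + vε‖ ≤ ε * ‖(g : H)‖ + ‖A.adjoint g‖ := by
    refine (sq_le_sq₀ (by positivity) (by positivity)).1 ?_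
    nlinarith [sq_nonneg (ε * ‖uε - vε‖)]
  have hAd_add : ‖A d‖ ≤ ε * ‖uε + vε‖ := by
    refine le_of_mul_self_le_mul_nonneg (norm_nonneg _) (by positivity) ?_
    nlinarith [norm_inner_le_norm (𝕜 := ℂ) (uε + vε) (A d)]
  have hAd_sub : ‖A d‖ ≤ ε * C * (ε * ‖uε - vε‖) := by
    refine le_of_mul_self_le_mul_nonneg (norm_nonneg _) (by positivity) ?_
    calc ‖A d‖ * ‖A d‖ = ‖A d‖ ^ 2 := (sq _).symm
      _ ≤ ε * ‖⟪uε + vε, A d⟫‖ := hsq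
      _ ≤ ε * (ε * ‖uε - vε‖ * ‖(d : H)‖) := by
        have h := norm_inner_le_norm (𝕜 := ℂ) (a • (uε - vε)) (d : H)
        rw [norm_smul, hna, ← hadd] at h
        gcongr
      _ ≤ ε * (ε * ‖uε - vε‖ * (C * ‖A d‖)) := by gcongr; exact hbound d
      _ = ‖A d‖ * (ε * C * (ε * ‖uε - vε‖)) := by ring
  have hkey : ‖A d‖ ≤ ε * (‖(g : H)‖ + C * ‖A.adjoint g‖) := by
    rcases le_total (ε * C) 1 with h | h
    · calc ‖A d‖ ≤ ε * C * (ε * ‖(g : H)‖ + ‖A.adjoint g‖) :=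
            hAd_sub.trans (by gcongr)
        _ = ε * (ε * C * ‖(g : H)‖ + C * ‖A.adjoint g‖) := by ring
        _ ≤ ε * (1 * ‖(g : H)‖ + C * ‖A.adjoint g‖) := by gcongr
        _ = _ := by ring
    · calc ‖A d‖ ≤ ε * ‖(g : H)‖ + 1 * ‖A.adjoint g‖ := by linarith
        _ ≤ ε * ‖(g : H)‖ + ε * C * ‖A.adjoint g‖ := by gcongr
        _ = _ := by ring
  calc ‖(d : H)‖ ≤ C * ‖A d‖ := hbound d
    _ ≤ C * (ε * (‖(g : H)‖ + C * ‖A.adjoint g‖)) := by gcongr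
    _ = _ := by ring
end
end

section
/- Suppose g ∈ D(A*) decomposes as g = f + B u₁ + u₀ with f ∈ D(A), u₀, u₁ ∈ ker A*, and suppose that for each ε > 0 there are f_ε ∈ D(A), u_ε ∈ ker(A* − iε), v_ε ∈ ker(A* + iε) with g = f_ε + u_ε − v_ε. Then ⟨(u_ε − v_ε) − B(A*(u_ε − v_ε)), iε·(u_ε + v_ε)⟩ → ⟨u₀, u₁⟩ as ε → 0⁺. (This is the pointwise form of the formula ⟨u, T u⟩ = lim_{ε↓0} iε·⟨(1 − S_D⁻¹S̃)(u_ε − U_ε u_ε), u_ε + U_ε u_ε⟩ recovering the Kreĭn–Višik–Birman extension parameter T from the von Neumann parameters U_ε.) -/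
open Complex Filter
open scoped ComplexInnerProductSpace

noncomputable section

variable {H : Type*} [NormedAddCommGroup H] [InnerProductSpace ℂ H] [CompleteSpace H]

/-- A self-adjoint extension of a densely defined operator is a restriction of its adjoint. -/
theorem LinearPMap.le_adjoint_of_le_of_adjoint_eq {A S : H →ₗ.[ℂ] H}
    (hA : Dense (A.domain : Set H)) (hS : S.adjoint = S) (hAS : A ≤ S) : S ≤ A.adjoint := by
  have hSdense : Dense (S.domain : Set H) := hA.mono hAS.1
  refine LinearPMap.IsFormalAdjoint.le_adjoint hA fun x y => ?_
  have hxy := S.adjoint_isFormalAdjoint hSdense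
  rw [hS] at hxy
  have hx : A x = S ⟨x, hAS.1 x.2⟩ := hAS.2 rfl
  rw [hx]
  exact hxy ⟨x, hAS.1 x.2⟩ y

theorem inner_apply_eq_zero_of_mem_pKer_adjoint {A : H →ₗ.[ℂ] H}
    (hA : Dense (A.domain : Set H)) {w : H} (hw : w ∈ pKer A.adjoint 0) (x : A.domain) :
    ⟪w, A x⟫ = 0 := by
  obtain ⟨hw, hAw⟩ := hw
  rw [← A.adjoint_isFormalAdjoint hA ⟨w, hw⟩ x, hAw, zero_smul, inner_zero_left]

theorem apply_sub_eq_of_mem_pKer {T : H →ₗ.[ℂ] H} {z : ℂ} {u v : H}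
    (hu : u ∈ pKer T z) (hv : v ∈ pKer T (-z)) (h : u - v ∈ T.domain) :
    T ⟨u - v, h⟩ = z • (u + v) := by
  obtain ⟨hu, hTu⟩ := hu
  obtain ⟨hv, hTv⟩ := hv
  have hsub : (⟨u - v, h⟩ : T.domain) = ⟨u, hu⟩ - ⟨v, hv⟩ := rfl
  rw [hsub, T.map_sub, hTu, hTv, neg_smul, sub_neg_eq_add, smul_add]

theorem statement_17
    (A : H →ₗ.[ℂ] H)
    (hdense : Dense (A.domain : Set H))
    (hclosed : A.IsClosed)
    (hsym : ∀ f g : A.domain, ⟪(f : H), (A g : H)⟫ = ⟪(A f : H), (g : H)⟫)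
    (C : ℝ) (hC : 0 < C)
    (hbound : ∀ f : A.domain, ‖(f : H)‖ ≤ C * ‖A f‖)
    (hker : ∀ z : ℂ, IsClosed ((pKer A.adjoint z : Set H)))
    (SD : H →ₗ.[ℂ] H) (hSDsa : SD.adjoint = SD) (hASD : A ≤ SD)
    (B : H →L[ℂ] H) (b : ℝ) (hb : ‖B‖ = b)
    (hB1 : ∀ x : SD.domain, B (SD x) = x)
    (hB2 : ∀ y : H, ∃ hy : B y ∈ SD.domain, SD ⟨B y, hy⟩ = y)
    (g : A.adjoint.domain) (f : A.domain) (u₀ u₁ : H)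
    (hu₀ : u₀ ∈ pKer A.adjoint 0) (hu₁ : u₁ ∈ pKer A.adjoint 0)
    (hg : (g : H) = (f : H) + B u₁ + u₀)
    (fε : ℝ → A.domain) (u v : ℝ → H)
    (hdec : ∀ ε : ℝ, 0 < ε →
      u ε ∈ pKer A.adjoint ((ε : ℂ) * I) ∧
      v ε ∈ pKer A.adjoint (-((ε : ℂ) * I)) ∧
      (g : H) = (fε ε : H) + u ε - v ε)
    (hmem : ∀ ε : ℝ, u ε - v ε ∈ A.adjoint.domain) :
    Tendsto (fun ε : ℝ =>
        ⟪(u ε - v ε) - B (A.adjoint ⟨u ε - v ε, hmem ε⟩), ((ε : ℂ) * I) • (u ε + v ε)⟫)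
      (nhdsWithin 0 (Set.Ioi 0)) (nhds ⟪u₀, u₁⟫) := by
  have hSDle : SD ≤ A.adjoint := LinearPMap.le_adjoint_of_le_of_adjoint_eq hdense hSDsa hASD
  have hAle : A ≤ A.adjoint := hASD.trans hSDle
  have hBA : ∀ x : A.domain, B (A x) = x := fun x => by
    have hx : A x = SD ⟨x, hASD.1 x.2⟩ := hASD.2 rfl
    rw [hx, hB1]
  have hAg : A.adjoint g = A f + u₁ := by
    obtain ⟨hd₀, hA₀⟩ := hu₀
    obtain ⟨hd₁, hSB⟩ := hB2 u₁
    have hsum : g = ⟨f, hAle.1 f.2⟩ + ⟨B u₁, hSDle.1 hd₁⟩ + ⟨u₀, hd₀⟩ := Subtype.ext hg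
    have hf : A f = A.adjoint ⟨f, hAle.1 f.2⟩ := hAle.2 rfl
    have hB : SD ⟨B u₁, hd₁⟩ = A.adjoint ⟨B u₁, hSDle.1 hd₁⟩ := hSDle.2 rfl
    rw [hsum, LinearPMap.map_add, LinearPMap.map_add, ← hf, ← hB, hSB, hA₀, zero_smul, add_zero]
  refine tendsto_const_nhds.congr' ?_
  filter_upwards [self_mem_nhdsWithin] with ε hε
  obtain ⟨hu, hv, hgε⟩ := hdec ε hε
  have hAuv : A.adjoint ⟨u ε - v ε, hmem ε⟩ = A (f - fε ε) + u₁ := by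
    have hsub : (⟨u ε - v ε, hmem ε⟩ : A.adjoint.domain) = g - ⟨fε ε, hAle.1 (fε ε).2⟩ :=
      Subtype.ext <| by
        change u ε - v ε = (g : H) - fε ε
        rw [hgε]
        abel
    have hf : A (fε ε) = A.adjoint ⟨fε ε, hAle.1 (fε ε).2⟩ := hAle.2 rfl
    rw [hsub, LinearPMap.map_sub, hAg, ← hf, LinearPMap.map_sub]
    abel
  have hleft : (u ε - v ε) - B (A.adjoint ⟨u ε - v ε, hmem ε⟩) = u₀ := by
    have huv : u ε - v ε = (f : H) + B u₁ + u₀ - fε ε := by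
      rw [← hg, hgε]
      abel
    rw [hAuv, map_add, hBA, huv, Submodule.coe_sub]
    abel
  rw [hleft, ← apply_sub_eq_of_mem_pKer hu hv (hmem ε), hAuv, inner_add_right,
    inner_apply_eq_zero_of_mem_pKer_adjoint hdense hu₀, zero_add]
end
end
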